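/- For every real ε > 0 there exists N such that for all integers n ≥ N, one has f(n, n) > (2/√e − ε) · n · √(log n / log log n). (Here log denotes the natural logarithm and e is Euler's number.) -/

import Mathlib

open Real

/-- `f n m` is the least nonnegative integer `L` such that the interval `(m, m + L]`
contains `n` distinct integers `a 1, ..., a n` with `i ∣ a i` for all `1 ≤ i ≤ n`. -/
noncomputable def f (n m : ℕ) : ℕ :=
  sInf {L : ℕ | ∃ a : ℕ → ℕ,
    (∀ i ∈ Finset.Icc 1 n, i ∣ a i) ∧
    (∀ i ∈ Finset.Icc 1 n, m < a i ∧ a i ≤ m + L) ∧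
    Set.InjOn a (Finset.Icc 1 n)}

open Filter Topology MeasureTheory

/-- The triangle function is integrable against characters, with transform `4 sinc²`. -/
theorem integral_triangle_exp (v : ℝ) :
    ∫ τ in (-2 : ℝ)..2, ((2 - |τ| : ℝ) : ℂ) * Complex.exp (τ * v * Complex.I) =
      ((4 * sinc v ^ 2 : ℝ) : ℂ) := by
  have hc : Continuous fun τ : ℝ ↦ ((2 - |τ| : ℝ) : ℂ) * Complex.exp (τ * v * Complex.I) := by
    fun_prop
  rw [← intervalIntegral.integral_add_adjacent_intervals (b := 0) (hc.intervalIntegrable _ _)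
    (hc.intervalIntegrable _ _)]
  have hneg : ∫ τ in (-2 : ℝ)..0, ((2 - |τ| : ℝ) : ℂ) * Complex.exp (τ * v * Complex.I) =
      ∫ τ in (-2 : ℝ)..0, (2 + (τ : ℂ)) * Complex.exp (τ * v * Complex.I) := by
    refine intervalIntegral.integral_congr fun τ hτ ↦ ?_
    rw [Set.uIcc_of_le (by norm_num)] at hτ
    rw [abs_of_nonpos hτ.2]
    push_cast; ring
  have hpos : ∫ τ in (0 : ℝ)..2, ((2 - |τ| : ℝ) : ℂ) * Complex.exp (τ * v * Complex.I) =
      ∫ τ in (0 : ℝ)..2, (2 - (τ : ℂ)) * Complex.exp (τ * v * Complex.I) := by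
    refine intervalIntegral.integral_congr fun τ hτ ↦ ?_
    rw [Set.uIcc_of_le (by norm_num)] at hτ
    rw [abs_of_nonneg hτ.1]
    push_cast; ring
  rw [hneg, hpos]
  have key (σ : ℂ) (hσ : σ ≠ 0) (a b : ℝ) (hv : v ≠ 0) :
      ∫ τ in a..b, (2 + σ * (τ : ℂ)) * Complex.exp (τ * v * Complex.I) =
      ((2 + σ * b) / (v * Complex.I) + σ / v ^ 2) * Complex.exp (b * v * Complex.I) -
      ((2 + σ * a) / (v * Complex.I) + σ / v ^ 2) * Complex.exp (a * v * Complex.I) := by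
    have hv' : (v : ℂ) ≠ 0 := by exact_mod_cast hv
    refine intervalIntegral.integral_eq_sub_of_hasDerivAt
      (f := fun τ : ℝ ↦ ((2 + σ * τ) / (v * Complex.I) + σ / v ^ 2) *
        Complex.exp (τ * v * Complex.I)) (fun τ _ ↦ ?_) ?_
    · have h1 : HasDerivAt (fun τ : ℝ ↦ (τ : ℂ)) 1 τ := Complex.ofRealCLM.hasDerivAt
      have h2 := ((h1.mul_const (v : ℂ)).mul_const Complex.I).cexp
      have h3 := ((((h1.const_mul σ).const_add 2).div_const (v * Complex.I)).add_const
        (σ / v ^ 2)).mul h2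
      convert! h3 using 1
      field_simp
      linear_combination (-σ) * Complex.I_sq
    · apply Continuous.intervalIntegrable
      fun_prop
  rcases eq_or_ne v 0 with rfl | hv
  · have key0 (σ : ℂ) (a b : ℝ) : ∫ τ in a..b, (2 + σ * (τ : ℂ)) =
        (2 * b + σ * b ^ 2 / 2) - (2 * a + σ * a ^ 2 / 2) := by
      refine intervalIntegral.integral_eq_sub_of_hasDerivAt
        (f := fun τ : ℝ ↦ 2 * (τ : ℂ) + σ * (τ : ℂ) ^ 2 / 2) (fun τ _ ↦ ?_) ?_
      · have h1 : HasDerivAt (fun τ : ℝ ↦ (τ : ℂ)) 1 τ := Complex.ofRealCLM.hasDerivAt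
        convert! (h1.const_mul 2).add (((h1.pow 2).const_mul σ).div_const 2) using 1
        push_cast; ring
      · apply Continuous.intervalIntegrable
        fun_prop
    have h1 := key0 1 (-2) 0
    have h2 := key0 (-1) 0 2
    simp only [one_mul, neg_one_mul, ← sub_eq_add_neg] at h1 h2
    simp only [Complex.ofReal_zero, mul_zero, zero_mul, Complex.exp_zero, mul_one, h1, h2, sinc_zero]
    push_cast; norm_num
  · have h1 := key 1 one_ne_zero (-2) 0 hv
    have h2 := key (-1) (by norm_num) 0 2 hv
    simp only [one_mul, neg_one_mul, ← sub_eq_add_neg] at h1 h2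
    rw [h1, h2, sinc_of_ne_zero hv]
    have hv' : (v : ℂ) ≠ 0 := by exact_mod_cast hv
    have e2 : Complex.exp (((2 : ℝ) : ℂ) * v * Complex.I) = Complex.exp (v * Complex.I) ^ 2 := by
      rw [← Complex.exp_nat_mul]; push_cast; ring_nf
    have e3 : Complex.exp (((-2 : ℝ) : ℂ) * v * Complex.I) = Complex.exp (-v * Complex.I) ^ 2 := by
      rw [← Complex.exp_nat_mul]; push_cast; ring_nf
    have e4 : Complex.exp (v * Complex.I) * Complex.exp (-v * Complex.I) = 1 := by
      rw [← Complex.exp_add]; simp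
    rw [e2, e3]
    push_cast
    rw [Complex.sin]
    generalize Complex.exp (v * Complex.I) = E at *
    generalize Complex.exp (-v * Complex.I) = E' at *
    simp
    field_simp
    ring_nf
    linear_combination (-8 * Complex.I) * e4 -
      Complex.I * (-8 * E' * E + 4 * E' ^ 2 + 4 * E ^ 2) * Complex.I_sq

theorem sinc_sq_le (v : ℝ) : sinc v ^ 2 ≤ 2 * (1 + v ^ 2)⁻¹ := by
  rcases eq_or_ne v 0 with rfl | hv
  · simp
  rw [← div_eq_mul_inv, le_div_iff₀ (by positivity)]
  have h1 : sinc v ^ 2 ≤ 1 := by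
    rw [sq_le_one_iff_abs_le_one]; exact abs_sinc_le_one v
  have h2 : sinc v ^ 2 * v ^ 2 ≤ 1 := by
    rw [sinc_of_ne_zero hv, div_pow, div_mul_cancel₀ _ (by positivity)]
    exact sin_sq_le_one v
  linarith

theorem integrable_sinc_sq : Integrable fun v : ℝ ↦ sinc v ^ 2 := by
  refine (integrable_inv_one_add_sq.const_mul 2).mono' (by fun_prop) (ae_of_all _ fun v ↦ ?_)
  rw [Real.norm_of_nonneg (by positivity)]
  exact sinc_sq_le v

/-- A bounded function whose Laplace transform extends continuously to the imaginary axis has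
Fejér means tending to zero at infinity. -/
theorem tendsto_fejer_mean_of_laplace {B : ℝ → ℝ} {C : ℝ} {H : ℂ → ℂ} (hB : Measurable B)
    (hC : ∀ t, |B t| ≤ C) (hH : ContinuousOn H {s | 0 ≤ s.re})
    (hBH : ∀ s : ℂ, 0 < s.re → ∫ t in Set.Ioi (0 : ℝ), (B t : ℂ) * Complex.exp (-s * t) = H s)
    {l : ℝ} (hl : 0 < l) :
    Tendsto (fun x : ℝ ↦ ∫ t in Set.Ioi (0 : ℝ), B t * sinc (l * (x - t)) ^ 2) atTop (𝓝 0) := by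
  have hC0 : 0 ≤ C := (abs_nonneg _).trans (hC 0)
  -- the Fubini identity for the damped integral
  have hfub (ε : ℝ) (hε : 0 < ε) (x : ℝ) :
      ∫ t in Set.Ioi (0 : ℝ), ((B t * exp (-ε * t) * (4 * sinc (l * (x - t)) ^ 2) : ℝ) : ℂ) =
      ∫ τ in (-2 : ℝ)..2, ((2 - |τ| : ℝ) : ℂ) * Complex.exp (τ * (l * x) * Complex.I) *
        H (ε + l * τ * Complex.I) := by
    have h_int : IntegrableOn (fun t ↦ ((B t * exp (-ε * t) : ℝ) : ℂ)) (Set.Ioi 0) := by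
      suffices h : IntegrableOn (fun t ↦ B t * exp (-ε * t)) (Set.Ioi 0) from h.ofReal
      refine ((integrableOn_exp_mul_Ioi (neg_lt_zero.2 hε) 0).const_mul C).mono'
        (Measurable.aestronglyMeasurable (by fun_prop)) (ae_of_all _ fun t ↦ ?_)
      rw [norm_mul, norm_eq_abs, norm_eq_abs, abs_exp]
      gcongr
      exact hC t
    have hint2 : IntegrableOn (fun τ : ℝ ↦ ((2 - |τ| : ℝ) : ℂ)) (Set.uIoc (-2) 2) := by
      rw [← intervalIntegrable_iff]
      exact Continuous.intervalIntegrable (by fun_prop) _ _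
    have hswap := intervalIntegral_integral_swap (a := -2) (b := 2)
      (μ := volume.restrict (Set.Ioi (0 : ℝ)))
      (f := fun τ t ↦ ((2 - |τ| : ℝ) : ℂ) * ((B t * exp (-ε * t) : ℝ) : ℂ) *
        Complex.exp (τ * (l * (x - t) : ℝ) * Complex.I)) ?_
    · calc _ = ∫ t in Set.Ioi (0 : ℝ), ∫ τ in (-2 : ℝ)..2,
            ((2 - |τ| : ℝ) : ℂ) * ((B t * exp (-ε * t) : ℝ) : ℂ) *
              Complex.exp (τ * (l * (x - t) : ℝ) * Complex.I) := by
            refine integral_congr_ae (ae_of_all _ fun t ↦ ?_)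
            simp only
            rw [Complex.ofReal_mul, ← integral_triangle_exp, ← intervalIntegral.integral_const_mul]
            refine intervalIntegral.integral_congr fun τ _ ↦ ?_
            ring
        _ = _ := by
            rw [← hswap]
            refine intervalIntegral.integral_congr fun τ _ ↦ ?_
            rw [← hBH _ (by simpa using hε), ← integral_const_mul]
            refine integral_congr_ae (ae_of_all _ fun t ↦ ?_)
            simp only
            push_cast
            have : Complex.exp (τ * (l * (x - t)) * Complex.I) * Complex.exp (-ε * t) =
              Complex.exp (τ * (l * x) * Complex.I) *
                Complex.exp (-(ε + l * τ * Complex.I) * t) := by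
              rw [← Complex.exp_add, ← Complex.exp_add]; congr 1; ring
            linear_combination ((2 : ℂ) - (|τ| : ℝ)) * B t * this
    · refine (hint2.mul_prod h_int).mul_bdd (c := 1) ?_ (ae_of_all _ fun p ↦ ?_)
      · apply Continuous.aestronglyMeasurable
        fun_prop
      · rw [← Complex.ofReal_mul, Complex.norm_exp_ofReal_mul_I]
  have hline : Continuous fun τ : ℝ ↦ H (l * τ * Complex.I) :=
    hH.comp_continuous (by fun_prop) (by simp)
  -- let the damping go to zero
  have hlim (x : ℝ) :
      ∫ t in Set.Ioi (0 : ℝ), ((B t * (4 * sinc (l * (x - t)) ^ 2) : ℝ) : ℂ) =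
      ∫ τ in (-2 : ℝ)..2, ((2 - |τ| : ℝ) : ℂ) * Complex.exp (τ * (l * x) * Complex.I) *
        H (l * τ * Complex.I) := by
    have h1 : Tendsto (fun ε : ℝ ↦ ∫ t in Set.Ioi (0 : ℝ),
        ((B t * exp (-ε * t) * (4 * sinc (l * (x - t)) ^ 2) : ℝ) : ℂ)) (𝓝[>] 0)
        (𝓝 (∫ t in Set.Ioi (0 : ℝ), ((B t * (4 * sinc (l * (x - t)) ^ 2) : ℝ) : ℂ))) := by
      refine tendsto_integral_filter_of_dominated_convergence
        (fun t ↦ C * (4 * sinc (l * (x - t)) ^ 2)) (Eventually.of_forall fun ε ↦ ?_) ?_ ?_ ?_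
      · have : Measurable fun t : ℝ ↦ sinc (l * (x - t)) := by fun_prop
        exact Measurable.aestronglyMeasurable (by fun_prop)
      · filter_upwards [self_mem_nhdsWithin] with ε hε
        filter_upwards [ae_restrict_mem measurableSet_Ioi] with t ht
        rw [Complex.norm_real, norm_mul, norm_mul, norm_eq_abs, norm_eq_abs, abs_exp,
          Real.norm_of_nonneg (by positivity : 0 ≤ 4 * sinc (l * (x - t)) ^ 2)]
        have : exp (-ε * t) ≤ 1 := by
          rw [exp_le_one_iff]
          have := mul_pos (Set.mem_Ioi.1 hε) (Set.mem_Ioi.1 ht)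
          linarith
        gcongr
        exact (mul_le_of_le_one_right (abs_nonneg _) this).trans (hC t)
      · have := ((integrable_sinc_sq.comp_mul_left' hl.ne').comp_sub_left x).const_mul 4
        exact (this.const_mul C).integrableOn
      · refine ae_of_all _ fun t ↦ ?_
        have : Continuous fun ε : ℝ ↦
          ((B t * exp (-ε * t) * (4 * sinc (l * (x - t)) ^ 2) : ℝ) : ℂ) := by fun_prop
        simpa using (this.tendsto 0).mono_left nhdsWithin_le_nhds
    have h2 : Tendsto (fun ε : ℝ ↦ ∫ τ in (-2 : ℝ)..2, ((2 - |τ| : ℝ) : ℂ) *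
        Complex.exp (τ * (l * x) * Complex.I) * H (ε + l * τ * Complex.I)) (𝓝[>] 0)
        (𝓝 (∫ τ in (-2 : ℝ)..2, ((2 - |τ| : ℝ) : ℂ) * Complex.exp (τ * (l * x) * Complex.I) *
        H (l * τ * Complex.I))) := by
      have hH' : Continuous fun p : ℝ × ℝ ↦ H (((max p.1 0 : ℝ) : ℂ) + l * p.2 * Complex.I) :=
        hH.comp_continuous (by fun_prop) (by simp)
      have hcont : Continuous fun ε : ℝ ↦ ∫ τ in (-2 : ℝ)..2, ((2 - |τ| : ℝ) : ℂ) *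
          Complex.exp (τ * (l * x) * Complex.I) *
            H (((max ε 0 : ℝ) : ℂ) + l * τ * Complex.I) := by
        apply intervalIntegral.continuous_parametric_intervalIntegral_of_continuous'
        simp only [Function.uncurry_def]
        exact Continuous.mul (by fun_prop) hH'
      have := (hcont.tendsto 0).mono_left (nhdsWithin_le_nhds (s := Set.Ioi 0))
      simp only [max_self, Complex.ofReal_zero, zero_add] at this
      refine this.congr' ?_
      filter_upwards [self_mem_nhdsWithin] with ε hε
      rw [max_eq_left (le_of_lt hε)]
    refine tendsto_nhds_unique (h1.congr' ?_) h2
    filter_upwards [self_mem_nhdsWithin] with ε hε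
    exact hfub ε hε x
  -- the Riemann-Lebesgue lemma
  have hRL : Tendsto (fun x : ℝ ↦ ∫ τ in (-2 : ℝ)..2, ((2 - |τ| : ℝ) : ℂ) *
      Complex.exp (τ * (l * x) * Complex.I) * H (l * τ * Complex.I)) atTop (𝓝 0) := by
    have h := (Real.tendsto_integral_exp_smul_cocompact ((Set.Ioc (-2 : ℝ) 2).indicator
      fun τ : ℝ ↦ ((2 - |τ| : ℝ) : ℂ) * H (l * τ * Complex.I))).mono_left atBot_le_cocompact
    have hx : Tendsto (fun x : ℝ ↦ -(l / (2 * π)) * x) atTop atBot :=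
      tendsto_id.const_mul_atTop_of_neg (neg_lt_zero.2 (by positivity))
    refine (h.comp hx).congr fun x ↦ ?_
    rw [intervalIntegral.integral_of_le (by norm_num), ← integral_indicator measurableSet_Ioc]
    refine integral_congr_ae (ae_of_all _ fun τ ↦ ?_)
    by_cases hτ : τ ∈ Set.Ioc (-2 : ℝ) 2
    · simp only [Set.indicator_of_mem hτ, Circle.smul_def, Real.fourierChar_apply, smul_eq_mul]
      have : 2 * π * -(τ * (-(l / (2 * π)) * x)) = τ * (l * x) := by
        field_simp
      rw [this]
      push_cast
      ring
    · simp only [Set.indicator_of_notMem hτ, smul_zero]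
  have h4 : Tendsto (fun x : ℝ ↦ ∫ t in Set.Ioi (0 : ℝ), B t * (4 * sinc (l * (x - t)) ^ 2))
      atTop (𝓝 0) := by
    rw [← Filter.tendsto_ofReal_iff, Complex.ofReal_zero]
    refine (hRL.congr fun x ↦ ?_)
    rw [← hlim]
    exact integral_ofReal
  have h5 := h4.div_const 4
  rw [zero_div] at h5
  refine h5.congr fun x ↦ ?_
  rw [← integral_div]
  refine integral_congr_ae (ae_of_all _ fun t ↦ ?_)
  ring

open ArithmeticFunction in
/-- The logarithmic derivative of the zeta function, with its pole removed, is continuous on the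
closed half-plane to the right of `1`. -/
theorem exists_continuousOn_LSeries_vonMangoldt_sub :
    ∃ F : ℂ → ℂ, ContinuousOn F {s | 1 ≤ s.re} ∧
      ∀ s : ℂ, 1 < s.re → F s = LSeries (fun n ↦ (vonMangoldt n : ℂ)) s - 1 / (s - 1) := by
  refine ⟨_, vonMangoldt.continuousOn_LFunctionResidueClassAux (q := 1) 1, fun s hs ↦ ?_⟩
  rw [vonMangoldt.eqOn_LFunctionResidueClassAux (q := 1) isUnit_one hs]
  have : vonMangoldt.residueClass (1 : ZMod 1) = fun n ↦ vonMangoldt n := by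
    ext n
    simp [vonMangoldt.residueClass, Subsingleton.elim _ (1 : ZMod 1)]
  simp [this]

open ArithmeticFunction in
theorem LSeries_vonMangoldt_eq_integral_exp {z : ℂ} (hz : 0 < z.re) :
    LSeries (fun n ↦ (vonMangoldt n : ℂ)) (1 + z) = (1 + z) * ∫ t in Set.Ioi (0 : ℝ),
      ((Chebyshev.psi (exp t) * exp (-t) : ℝ) : ℂ) * Complex.exp (-z * t) := by
  rw [LSeries_eq_mul_integral_of_nonneg (r := 1) _ zero_le_one (by simpa using hz) ?_
    fun _ ↦ vonMangoldt_nonneg]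
  · congr 1
    have := integral_comp_exp_Ioi (fun t : ℝ ↦
      ((Chebyshev.psi t : ℝ) : ℂ) * (t : ℂ) ^ (-(1 + z + 1))) 0
    rw [exp_zero] at this
    convert this.symm using 1
    · refine setIntegral_congr_fun measurableSet_Ioi fun t ht ↦ ?_
      simp only [Chebyshev.psi]
      push_cast
      rfl
    · refine setIntegral_congr_fun measurableSet_Ioi fun t ht ↦ ?_
      simp only [Complex.real_smul]
      rw [Complex.cpow_def_of_ne_zero (by simp), ← Complex.ofReal_log (exp_pos t).le,
        log_exp]
      push_cast
      have : Complex.exp (-t) * Complex.exp (-z * t) =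
          Complex.exp t * Complex.exp (t * -(1 + z + 1)) := by
        rw [← Complex.exp_add, ← Complex.exp_add]; congr 1; ring
      linear_combination (Chebyshev.psi (exp t) : ℂ) * this
  · refine Asymptotics.IsBigO.of_bound (Real.log 4 + 4) (Eventually.of_forall fun n ↦ ?_)
    have h := Chebyshev.psi_le_const_mul_self (x := n) (by positivity)
    have h0 := Chebyshev.psi_nonneg (n : ℝ)
    have e : Chebyshev.psi n = ∑ k ∈ Finset.Icc 1 n, vonMangoldt k := by
      rw [Chebyshev.psi, Nat.floor_natCast]; rfl
    rw [← e, norm_of_nonneg h0, rpow_one, norm_of_nonneg (by positivity)]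
    exact h

theorem psi_exp_mul_exp_neg_le (t : ℝ) : Chebyshev.psi (exp t) * exp (-t) ≤ log 4 + 4 := by
  rw [exp_neg, ← div_eq_mul_inv, div_le_iff₀ (exp_pos t)]
  exact Chebyshev.psi_le_const_mul_self (exp_pos t).le

theorem psi_exp_mul_exp_neg_nonneg (t : ℝ) : 0 ≤ Chebyshev.psi (exp t) * exp (-t) :=
  mul_nonneg (Chebyshev.psi_nonneg _) (exp_pos _).le

theorem measurable_psi_exp_mul_exp_neg :
    Measurable fun t : ℝ ↦ Chebyshev.psi (exp t) * exp (-t) :=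
  (Chebyshev.psi_mono.measurable.comp measurable_exp).mul (by fun_prop)

theorem tendsto_fejer_mean_psi {l : ℝ} (hl : 0 < l) :
    Tendsto (fun x : ℝ ↦ ∫ t in Set.Ioi (0 : ℝ),
      (Chebyshev.psi (exp t) * exp (-t) - 1) * sinc (l * (x - t)) ^ 2) atTop (𝓝 0) := by
  obtain ⟨F, hF, hFs⟩ := exists_continuousOn_LSeries_vonMangoldt_sub
  have hlog : 0 < log 4 := log_pos (by norm_num)
  refine tendsto_fejer_mean_of_laplace (C := log 4 + 4) (H := fun z ↦ (F (1 + z) - 1) / (1 + z))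
    (measurable_psi_exp_mul_exp_neg.sub_const 1) (fun t ↦ ?_) ?_ (fun z hz ↦ ?_) hl
  · rw [abs_le]
    constructor <;> linarith [psi_exp_mul_exp_neg_le t, psi_exp_mul_exp_neg_nonneg t]
  · refine ContinuousOn.div ?_ (by fun_prop) fun z hz h ↦ ?_
    · refine ContinuousOn.sub (hF.comp (by fun_prop) fun z hz ↦ ?_) continuousOn_const
      simpa using hz
    · have := congrArg Complex.re h
      simp at this hz
      linarith
  · have hz0 : z ≠ 0 := by rintro rfl; simp at hz
    have hz1 : 1 + z ≠ 0 := by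
      intro h
      have := congrArg Complex.re h
      simp at this
      linarith
    have hexp : IntegrableOn (fun t : ℝ ↦ Complex.exp (-z * t)) (Set.Ioi 0) :=
      integrableOn_exp_mul_complex_Ioi (by simpa using hz) 0
    rw [hFs _ (by simpa using hz), LSeries_vonMangoldt_eq_integral_exp hz]
    have : ∫ t in Set.Ioi (0 : ℝ), Complex.exp (-z * t) = 1 / z := by
      rw [integral_exp_mul_complex_Ioi (by simpa using hz)]
      simp
    have hsub : ∫ t in Set.Ioi (0 : ℝ), ((Chebyshev.psi (exp t) * exp (-t) - 1 : ℝ) : ℂ) *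
        Complex.exp (-z * t) = (∫ t in Set.Ioi (0 : ℝ),
          ((Chebyshev.psi (exp t) * exp (-t) : ℝ) : ℂ) * Complex.exp (-z * t)) - 1 / z := by
      rw [← this, ← integral_sub ?_ hexp]
      · refine integral_congr_ae (ae_of_all _ fun t ↦ ?_)
        push_cast; ring
      · refine hexp.bdd_mul (c := log 4 + 4) ?_ (ae_of_all _ fun t ↦ ?_)
        · exact (Complex.measurable_ofReal.comp measurable_psi_exp_mul_exp_neg).aestronglyMeasurable
        · rw [Complex.norm_real, norm_of_nonneg (psi_exp_mul_exp_neg_nonneg t)]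
          exact psi_exp_mul_exp_neg_le t
    rw [hsub, add_sub_cancel_left]
    field_simp
    ring

/-- The upper bound in the prime number theorem, for the Chebyshev function. -/
theorem eventually_psi_le {ε : ℝ} (hε : 0 < ε) :
    ∀ᶠ x : ℝ in atTop, Chebyshev.psi x ≤ (1 + ε) * x := by
  set J : ℝ := ∫ v : ℝ, sinc v ^ 2 with hJ
  have hIJ : Tendsto (fun R : ℝ ↦ ∫ v in (-R)..R, sinc v ^ 2) atTop (𝓝 J) :=
    intervalIntegral_tendsto_integral integrable_sinc_sq tendsto_neg_atTop_atBot tendsto_id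
  have hJpos : 0 < J := by
    refine integral_pos_of_integrable_nonneg_nonzero (x := 0) (by fun_prop) integrable_sinc_sq
      (fun v ↦ by positivity) (by simp)
  have hlt : J * (1 + ε / 4) / (1 + ε) < J := by
    rw [div_lt_iff₀ (by positivity)]
    nlinarith
  obtain ⟨R, hRJ, hR⟩ := ((hIJ.eventually_const_lt hlt).and (eventually_gt_atTop 0)).exists
  set I : ℝ := ∫ v in (-R)..R, sinc v ^ 2 with hI
  set δ : ℝ := Real.log (1 + ε / 4) / 2 with hδ
  have hδ0 : 0 < δ := by
    have := log_pos (by linarith : 1 < 1 + ε / 4)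
    positivity
  have hexpδ : exp (2 * δ) = 1 + ε / 4 := by
    rw [hδ, mul_div_cancel₀ _ two_ne_zero, exp_log (by positivity)]
  set l : ℝ := R / δ with hl
  have hl0 : 0 < l := by positivity
  have hη : 0 < ((1 + ε) * I / (1 + ε / 4) - J) / l := by
    rw [div_lt_iff₀ (by positivity)] at hRJ
    refine div_pos ?_ hl0
    rw [sub_pos, lt_div_iff₀ (by positivity)]
    linarith
  have hmean := (tendsto_fejer_mean_psi hl0).eventually_lt_const hη
  have hmain : ∀ᶠ x : ℝ in atTop, Chebyshev.psi (exp x) * exp (-x) ≤ 1 + ε := by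
    filter_upwards [(tendsto_atTop_add_const_right _ δ tendsto_id).eventually hmean,
      eventually_gt_atTop 0] with x hx hx0
    simp only [id] at hx
    set g : ℝ → ℝ := fun t ↦ Chebyshev.psi (exp t) * exp (-t) with hg
    have hKint : Integrable fun t : ℝ ↦ sinc (l * (x + δ - t)) ^ 2 :=
      (integrable_sinc_sq.comp_mul_left' hl0.ne').comp_sub_left (x + δ)
    have hKtot : ∫ t : ℝ, sinc (l * (x + δ - t)) ^ 2 = J / l := by
      rw [integral_sub_left_eq_self (fun t ↦ sinc (l * t) ^ 2) volume (x + δ),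
        Measure.integral_comp_mul_left (fun t ↦ sinc t ^ 2) l, abs_of_pos (by positivity),
        smul_eq_mul, hJ]
      ring
    have hgK : Integrable fun t : ℝ ↦ g t * sinc (l * (x + δ - t)) ^ 2 := by
      refine hKint.bdd_mul (c := Real.log 4 + 4)
        measurable_psi_exp_mul_exp_neg.aestronglyMeasurable (ae_of_all _ fun t ↦ ?_)
      rw [norm_of_nonneg (psi_exp_mul_exp_neg_nonneg t)]
      exact psi_exp_mul_exp_neg_le t
    have hupper : ∫ t in Set.Ioi (0 : ℝ), g t * sinc (l * (x + δ - t)) ^ 2 <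
        (1 + ε) * I / (1 + ε / 4) / l := by
      have e : ∫ t in Set.Ioi (0 : ℝ), (g t - 1) * sinc (l * (x + δ - t)) ^ 2 =
          (∫ t in Set.Ioi (0 : ℝ), g t * sinc (l * (x + δ - t)) ^ 2) -
            ∫ t in Set.Ioi (0 : ℝ), sinc (l * (x + δ - t)) ^ 2 := by
        rw [← integral_sub hgK.integrableOn hKint.integrableOn]
        refine integral_congr_ae (ae_of_all _ fun t ↦ ?_)
        ring
      have h2 : ∫ t in Set.Ioi (0 : ℝ), sinc (l * (x + δ - t)) ^ 2 ≤ J / l := by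
        rw [← hKtot]
        exact setIntegral_le_integral hKint (ae_of_all _ fun t ↦ by positivity)
      rw [e, sub_div] at hx
      linarith
    have hlower : g x * exp (-(2 * δ)) * (I / l) ≤
        ∫ t in Set.Ioi (0 : ℝ), g t * sinc (l * (x + δ - t)) ^ 2 := by
      have e : ∫ t in x..(x + 2 * δ), sinc (l * (x + δ - t)) ^ 2 = I / l := by
        rw [intervalIntegral.integral_comp_sub_left (fun t ↦ sinc (l * t) ^ 2),
          intervalIntegral.integral_comp_mul_left (fun t ↦ sinc t ^ 2) hl0.ne', smul_eq_mul, hI]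
        have h1 : l * (x + δ - (x + 2 * δ)) = -R := by rw [hl]; field_simp; ring
        have h2 : l * (x + δ - x) = R := by rw [hl]; field_simp; ring
        rw [h1, h2]
        ring
      rw [← e, ← intervalIntegral.integral_const_mul,
        intervalIntegral.integral_of_le (by linarith)]
      calc _ ≤ ∫ t in Set.Ioc x (x + 2 * δ), g t * sinc (l * (x + δ - t)) ^ 2 := by
            refine setIntegral_mono_on (hKint.integrableOn.const_mul _) hgK.integrableOn
              measurableSet_Ioc fun t ht ↦ ?_
            gcongr
            simp only [hg]
            rw [mul_assoc, ← exp_add]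
            have h1 := Chebyshev.psi_mono (exp_le_exp.2 ht.1.le)
            have h2 : exp (-x + -(2 * δ)) ≤ exp (-t) := exp_le_exp.2 (by linarith [ht.2])
            exact mul_le_mul h1 h2 (exp_pos _).le (Chebyshev.psi_nonneg _)
        _ ≤ _ := by
            refine setIntegral_mono_set hgK.integrableOn (ae_of_all _ fun t ↦ ?_)
              (Eventually.of_forall fun t ht ↦ ?_)
            · exact mul_nonneg (psi_exp_mul_exp_neg_nonneg t) (by positivity)
            · exact hx0.trans ht.1
    have hIpos : 0 < I := lt_trans (by positivity) hRJ
    have h := hlower.trans hupper.le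
    rw [exp_neg, hexpδ] at h
    field_simp at h
    exact h
  filter_upwards [tendsto_log_atTop.eventually hmain, eventually_gt_atTop 0] with x hx hx0
  rwa [exp_log hx0, exp_neg, exp_log hx0, ← div_eq_mul_inv, div_le_iff₀ hx0] at hx

/-- The upper bound in the prime number theorem. -/
theorem eventually_primeCounting_le_one_add {ε : ℝ} (hε : 0 < ε) :
    ∀ᶠ x : ℝ in atTop, (Nat.primeCounting ⌊x⌋₊ : ℝ) ≤ (1 + ε) * x / log x := by
  filter_upwards [Chebyshev.integral_theta_div_log_sq_isLittleO.bound (half_pos hε),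
    eventually_psi_le (half_pos hε), eventually_ge_atTop 2] with x h1 h2 hx
  rw [Chebyshev.primeCounting_eq_theta_div_log_add_integral hx]
  have hlog : 0 < Real.log x := log_pos (by linarith)
  have h3 := (le_abs_self _).trans h1
  rw [norm_of_nonneg (by positivity : 0 ≤ x / Real.log x)] at h3
  have h4 : Chebyshev.theta x / Real.log x ≤ (1 + ε / 2) * x / Real.log x := by
    gcongr
    exact (Chebyshev.theta_le_psi x).trans h2
  calc _ ≤ (1 + ε / 2) * x / Real.log x + ε / 2 * (x / Real.log x) := add_le_add h4 h3
    _ = _ := by ring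

theorem integral_Iic_indicator_Ici_exp (c W : ℝ) {μ : ℝ} (hμ : μ ≠ 0) :
    ∫ w in Set.Iic W, (Set.Ici c).indicator (fun w ↦ exp (-μ * w)) w =
      (exp (-μ * min c W) - exp (-μ * W)) / μ := by
  rw [setIntegral_indicator measurableSet_Ici, Set.Iic_inter_Ici]
  rcases le_or_gt c W with h | h
  · rw [integral_Icc_eq_integral_Ioc, ← intervalIntegral.integral_of_le h, min_eq_left h,
      intervalIntegral.integral_comp_mul_left (fun x ↦ exp x) (neg_ne_zero.2 hμ), integral_exp,
      smul_eq_mul]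
    field_simp
    ring
  · rw [Set.Icc_eq_empty_of_lt h, min_eq_right h.le]
    simp

theorem integrableOn_Iic_indicator_Ici_exp (c W μ : ℝ) :
    IntegrableOn ((Set.Ici c).indicator fun w ↦ exp (-μ * w)) (Set.Iic W) := by
  rw [IntegrableOn, integrable_indicator_iff measurableSet_Ici, IntegrableOn,
    Measure.restrict_restrict measurableSet_Ici, Set.Ici_inter_Iic]
  exact Continuous.integrableOn_Icc (by fun_prop)

/-- A Laplace transform inequality for finitely many points whose counting function has
nonnegative skew second differences up to `W`. -/
theorem sum_exp_le_of_two_mul_card_le {ι : Type*} (A : Finset ι) (c : ι → ℝ) {W h₁ h₂ μ ν : ℝ}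
    (hμ : 0 < μ) (hν : 0 ≤ ν) (hνμ : ν ≤ μ)
    (h : ∀ w ≤ W, 2 * (A.filter fun i ↦ c i ≤ w).card ≤
      (A.filter fun i ↦ c i ≤ w + h₁).card + (A.filter fun i ↦ c i ≤ w - h₂).card) :
    (2 - exp (μ * h₁) - exp (-μ * h₂)) * ∑ i ∈ A, exp (-μ * c i) ≤
      2 * exp (-(μ - ν) * W) * ∑ i ∈ A, exp (-ν * c i) := by
  set φ : ℝ → ℝ := fun d ↦ (exp (-μ * min d W) - exp (-μ * W)) / μ with hφ
  have hcount (w d : ℝ) : ((A.filter fun i ↦ c i ≤ w + d).card : ℝ) * exp (-μ * w) =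
      ∑ i ∈ A, (Set.Ici (c i - d)).indicator (fun w ↦ exp (-μ * w)) w := by
    rw [Finset.card_filter, Nat.cast_sum, Finset.sum_mul]
    refine Finset.sum_congr rfl fun i _ ↦ ?_
    simp only [Set.indicator, Set.mem_Ici, sub_le_iff_le_add]
    split_ifs <;> simp
  have h_int (d : ℝ) : ∫ w in Set.Iic W, ((A.filter fun i ↦ c i ≤ w + d).card : ℝ) *
      exp (-μ * w) = ∑ i ∈ A, φ (c i - d) := by
    simp_rw [hcount]
    rw [integral_finsetSum _ fun i _ ↦ integrableOn_Iic_indicator_Ici_exp _ _ _]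
    exact Finset.sum_congr rfl fun i _ ↦ integral_Iic_indicator_Ici_exp _ _ hμ.ne'
  have hintg (d : ℝ) : IntegrableOn (fun w ↦ ((A.filter fun i ↦ c i ≤ w + d).card : ℝ) *
      exp (-μ * w)) (Set.Iic W) := by
    simp_rw [hcount]
    exact integrable_finsetSum _ fun i _ ↦ integrableOn_Iic_indicator_Ici_exp _ _ _
  have hineq : 2 * ∑ i ∈ A, φ (c i) ≤ ∑ i ∈ A, φ (c i - h₁) + ∑ i ∈ A, φ (c i + h₂) := by
    have e0 := h_int 0
    have e1 := h_int h₁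
    have e2 := h_int (-h₂)
    simp only [sub_zero, sub_neg_eq_add] at e0 e2
    rw [← e0, ← e1, ← e2, ← integral_const_mul, ← integral_add (hintg _) (hintg _)]
    refine setIntegral_mono_on ((hintg 0).const_mul 2) ((hintg h₁).add (hintg (-h₂)))
      measurableSet_Iic fun w hw ↦ ?_
    have := h w hw
    rw [← add_mul, ← mul_assoc]
    gcongr
    simp only [add_zero, ← sub_eq_add_neg]
    exact_mod_cast this
  have hup (d : ℝ) : φ d ≤ exp (-μ * d) / μ := by
    rcases le_or_gt d W with h | h
    · simp only [hφ, min_eq_left h]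
      gcongr
      linarith [exp_pos (-μ * W)]
    · simp only [hφ, min_eq_right h.le, sub_self, zero_div]
      positivity
  have hlow (d : ℝ) : (exp (-μ * d) - exp (-(μ - ν) * W) * exp (-ν * d)) / μ ≤ φ d := by
    rcases le_or_gt d W with h | h
    · simp only [hφ, min_eq_left h]
      gcongr
      rw [← exp_add]
      gcongr
      nlinarith
    · simp only [hφ, min_eq_right h.le, sub_self, zero_div]
      refine div_nonpos_of_nonpos_of_nonneg ?_ hμ.le
      rw [sub_nonpos, ← exp_add]
      gcongr
      nlinarith
  have hfin : 2 * ∑ i ∈ A, (exp (-μ * c i) - exp (-(μ - ν) * W) * exp (-ν * c i)) / μ ≤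
      ∑ i ∈ A, exp (-μ * (c i - h₁)) / μ + ∑ i ∈ A, exp (-μ * (c i + h₂)) / μ :=
    (mul_le_mul_of_nonneg_left (Finset.sum_le_sum fun i _ ↦ hlow _) two_pos.le).trans
      (hineq.trans (add_le_add (Finset.sum_le_sum fun i _ ↦ hup _)
        (Finset.sum_le_sum fun i _ ↦ hup _)))
  have e1 (i : ι) : exp (-μ * (c i - h₁)) = exp (μ * h₁) * exp (-μ * c i) := by
    rw [← exp_add]; ring_nf
  have e2 (i : ι) : exp (-μ * (c i + h₂)) = exp (-μ * h₂) * exp (-μ * c i) := by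
    rw [← exp_add]; ring_nf
  simp_rw [e1, e2, ← Finset.sum_div, Finset.sum_sub_distrib, ← Finset.mul_sum] at hfin
  rw [← add_div, mul_div_assoc', div_le_div_iff_of_pos_right hμ] at hfin
  linarith

/-- The monoid homomorphism `n ↦ n ^ (-μ)`. -/
noncomputable def natRpowNegHom (μ : ℝ) : ℕ →* ℝ where
  toFun n := (n : ℝ) ^ (-μ)
  map_one' := by simp
  map_mul' a b := by rw [Nat.cast_mul, mul_rpow (Nat.cast_nonneg a) (Nat.cast_nonneg b)]

theorem prime_rpow_neg_lt_one {p : ℕ} (hp : p.Prime) {μ : ℝ} (hμ : 0 < μ) :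
    (p : ℝ) ^ (-μ) < 1 :=
  rpow_lt_one_of_one_lt_of_neg (by exact_mod_cast hp.one_lt) (neg_lt_zero.2 hμ)

theorem hasSum_indicator_smoothNumbers_rpow_neg (N : ℕ) {μ : ℝ} (hμ : 0 < μ) :
    HasSum (Set.indicator N.smoothNumbers fun m ↦ (m : ℝ) ^ (-μ))
      (∏ p ∈ N.primesBelow, (1 - (p : ℝ) ^ (-μ))⁻¹) := by
  have h := (EulerProduct.summable_and_hasSum_smoothNumbers_prod_primesBelow_geometric
    (f := natRpowNegHom μ) (fun {p} hp ↦ ?_) N).2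
  · exact hasSum_subtype_iff_indicator.1 h
  · change ‖(p : ℝ) ^ (-μ)‖ < 1
    rw [norm_of_nonneg (by positivity)]
    exact prime_rpow_neg_lt_one hp hμ

theorem prod_primesBelow_rpow_neg_le (N : ℕ) {μ θ : ℝ} (hμ : 0 < μ) (hθ : 0 < θ) (hθ1 : θ ≤ 1) :
    ∏ p ∈ N.primesBelow, (1 - (p : ℝ) ^ (-(θ * μ)))⁻¹ ≤
      (θ⁻¹) ^ N.primesBelow.card * ∏ p ∈ N.primesBelow, (1 - (p : ℝ) ^ (-μ))⁻¹ := by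
  rw [← Finset.prod_const, ← Finset.prod_mul_distrib]
  refine Finset.prod_le_prod (fun p hp ↦ ?_) fun p hp ↦ ?_
  · have := prime_rpow_neg_lt_one (Nat.prime_of_mem_primesBelow hp) (mul_pos hθ hμ)
    exact inv_nonneg.2 (by linarith)
  · have h1 := prime_rpow_neg_lt_one (Nat.prime_of_mem_primesBelow hp) hμ
    have h2 : (p : ℝ) ^ (-(θ * μ)) ≤ 1 + θ * ((p : ℝ) ^ (-μ) - 1) := by
      have := rpow_one_add_le_one_add_mul_self (s := (p : ℝ) ^ (-μ) - 1) (p := θ)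
        (by have : (0 : ℝ) ≤ (p : ℝ) ^ (-μ) := by positivity
            linarith) hθ.le hθ1
      rwa [add_sub_cancel, ← rpow_mul (Nat.cast_nonneg p), show -μ * θ = -(θ * μ) by ring] at this
    rw [← mul_inv]
    apply inv_anti₀
    · exact mul_pos hθ (by linarith)
    · linarith

/-- If the counting function of the `N`-smooth numbers has nonnegative skew second differences
up to `W` on a logarithmic scale, then the transform of the difference operator is small. -/
theorem two_sub_exp_le_of_smoothNumbers {N : ℕ} {W h₁ h₂ μ θ : ℝ} (hμ : 0 < μ) (hθ : 0 < θ)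
    (hθ1 : θ ≤ 1)
    (h : ∀ T : Finset ℕ, (∀ m ∈ T, m ∈ N.smoothNumbers) →
      (∀ m ∈ N.smoothNumbers, log m ≤ W + h₁ → m ∈ T) → ∀ w ≤ W,
      2 * (T.filter fun m : ℕ ↦ log m ≤ w).card ≤
      (T.filter fun m : ℕ ↦ log m ≤ w + h₁).card + (T.filter fun m : ℕ ↦ log m ≤ w - h₂).card) :
    2 - exp (μ * h₁) - exp (-μ * h₂) ≤
      2 * exp (-((1 - θ) * μ * W)) * (θ⁻¹) ^ N.primesBelow.card := by
  classical
  have hsum := hasSum_indicator_smoothNumbers_rpow_neg N hμ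
  have hsum' := hasSum_indicator_smoothNumbers_rpow_neg N (mul_pos hθ hμ)
  have hPpos : 0 < ∏ p ∈ N.primesBelow, (1 - (p : ℝ) ^ (-μ))⁻¹ :=
    Finset.prod_pos fun p hp ↦ inv_pos.2 <| sub_pos.2 <|
      prime_rpow_neg_lt_one (Nat.prime_of_mem_primesBelow hp) hμ
  have key := le_of_tendsto_of_tendsto (hsum.mul_left (2 - exp (μ * h₁) - exp (-μ * h₂)))
    (hsum'.mul_left (2 * exp (-(μ - θ * μ) * W))) ?_
  · refine le_of_mul_le_mul_right (key.trans ?_) hPpos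
    rw [mul_assoc _ (θ⁻¹ ^ _)]
    have e : -(μ - θ * μ) * W = -((1 - θ) * μ * W) := by ring
    rw [e]
    gcongr
    exact prod_primesBelow_rpow_neg_le N hμ hθ hθ1
  · filter_upwards [eventually_ge_atTop (Finset.range (⌊exp (W + h₁)⌋₊ + 1))] with A hA
    rw [← Finset.mul_sum, ← Finset.mul_sum]
    have hconv (σ : ℝ) : ∑ m ∈ A, Set.indicator N.smoothNumbers (fun m ↦ (m : ℝ) ^ (-σ)) m =
        ∑ m ∈ A.filter (· ∈ N.smoothNumbers), exp (-σ * log m) := by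
      rw [Finset.sum_filter]
      refine Finset.sum_congr rfl fun m _ ↦ ?_
      by_cases hm : m ∈ N.smoothNumbers
      · rw [Set.indicator_of_mem hm, if_pos hm, rpow_def_of_pos, mul_comm]
        exact_mod_cast Nat.pos_of_ne_zero (Nat.ne_zero_of_mem_smoothNumbers hm)
      · rw [Set.indicator_of_notMem hm, if_neg hm]
    rw [hconv, hconv]
    refine sum_exp_le_of_two_mul_card_le _ (fun m : ℕ ↦ log m) hμ (mul_pos hθ hμ).le
      (mul_le_of_le_one_left hμ.le hθ1) (h _ (fun m hm ↦ (Finset.mem_filter.1 hm).2) ?_)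
    intro m hm hmW
    refine Finset.mem_filter.2 ⟨hA (Finset.mem_range.2 (Nat.lt_succ_of_le (Nat.le_floor ?_))), hm⟩
    rwa [← log_le_iff_le_exp]
    exact_mod_cast Nat.pos_of_ne_zero (Nat.ne_zero_of_mem_smoothNumbers hm)

theorem card_smoothNumbers_le_of_injOn {n L N b : ℕ} {a : ℕ → ℕ} {u v w : ℝ}
    (hdvd : ∀ i ∈ Finset.Icc 1 n, i ∣ a i) (hmem : ∀ i ∈ Finset.Icc 1 n, n < a i ∧ a i ≤ n + L)
    (hinj : Set.InjOn a (Finset.Icc 1 n)) (hb : 0 < b) (hN : 0 < N) {T : Finset ℕ}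
    (hT : ∀ s ∈ T, s ∈ N.smoothNumbers) (hT' : ∀ s ∈ N.smoothNumbers, log s ≤ v → s ∈ T)
    (hw : b * exp w ≤ n) (hv : (n + L : ℝ) ≤ b * exp v) (hu : (n + L : ℝ) ≤ N * (b * exp u)) :
    (T.filter fun s : ℕ ↦ u < log s ∧ log s ≤ w).card ≤
      (T.filter fun s : ℕ ↦ w < log s ∧ log s ≤ v).card := by
  have hb' : (0 : ℝ) < b := by exact_mod_cast hb
  have hN' : (0 : ℝ) < N := by exact_mod_cast hN
  have key : ∀ s ∈ T.filter fun s : ℕ ↦ u < log s ∧ log s ≤ w,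
      b * s ∈ Finset.Icc 1 n ∧ ∃ k, a (b * s) = b * (s * k) ∧ s * k ∈ N.smoothNumbers ∧
        w < log ↑(s * k) ∧ log ↑(s * k) ≤ v := by
    intro s hs
    obtain ⟨hsT, hus, hsw⟩ := Finset.mem_filter.1 hs
    have hs0 : 0 < s := Nat.pos_of_ne_zero (Nat.ne_zero_of_mem_smoothNumbers (hT s hsT))
    have hs0' : (0 : ℝ) < s := by exact_mod_cast hs0
    rw [log_le_iff_le_exp hs0'] at hsw
    rw [lt_log_iff_exp_lt hs0'] at hus
    have hbs : b * s ∈ Finset.Icc 1 n := by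
      refine Finset.mem_Icc.2 ⟨Nat.mul_pos hb hs0, ?_⟩
      have : (b * s : ℝ) ≤ n := (mul_le_mul_of_nonneg_left hsw hb'.le).trans hw
      exact_mod_cast this
    obtain ⟨k, hk⟩ := hdvd _ hbs
    obtain ⟨h₁, h₂⟩ := hmem _ hbs
    have hk0 : 0 < k := by
      rcases Nat.eq_zero_or_pos k with rfl | h
      · simp [hk] at h₁
      · exact h
    rw [hk, mul_assoc] at h₁ h₂
    have h₁' : (n : ℝ) < b * ↑(s * k) := by exact_mod_cast h₁
    have h₂' : b * ↑(s * k) ≤ (n + L : ℝ) := by exact_mod_cast h₂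
    have hkN : k < N := by
      have : (b * s * k : ℝ) < b * s * N := by
        calc (b * s * k : ℝ) = b * ↑(s * k) := by push_cast; ring
          _ ≤ N * (b * exp u) := h₂'.trans hu
          _ < N * (b * s) := by gcongr
          _ = b * s * N := by ring
      exact_mod_cast lt_of_mul_lt_mul_left this (by positivity)
    have hsk : (0 : ℝ) < ↑(s * k) := by exact_mod_cast Nat.mul_pos hs0 hk0
    refine ⟨hbs, k, by rw [hk, mul_assoc], Nat.mul_mem_smoothNumbers (hT s hsT)
      (Nat.mem_smoothNumbers_of_lt hk0 hkN), ?_, ?_⟩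
    · rw [lt_log_iff_exp_lt hsk]
      exact lt_of_mul_lt_mul_left (hw.trans_lt h₁') hb'.le
    · rw [log_le_iff_le_exp hsk]
      exact le_of_mul_le_mul_left (h₂'.trans hv) hb'
  refine Finset.card_le_card_of_injOn (fun s ↦ a (b * s) / b) ?_ ?_
  · intro s hs
    obtain ⟨-, k, hk, hsm, h₁, h₂⟩ := key s hs
    simp only [hk, Nat.mul_div_cancel_left _ hb]
    exact Finset.mem_coe.2 (Finset.mem_filter.2 ⟨hT' _ hsm h₂, h₁, h₂⟩)
  · intro s hs t ht hst
    obtain ⟨hs', k, hk, -⟩ := key s hs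
    obtain ⟨ht', l, hl, -⟩ := key t ht
    simp only [hk, hl, Nat.mul_div_cancel_left _ hb] at hst
    exact Nat.eq_of_mul_eq_mul_left hb (hinj hs' ht' (by rw [hk, hl, hst]))

theorem two_mul_card_smoothNumbers_le_of_injOn {n L N b : ℕ} {a : ℕ → ℕ} {u v w : ℝ}
    (hdvd : ∀ i ∈ Finset.Icc 1 n, i ∣ a i) (hmem : ∀ i ∈ Finset.Icc 1 n, n < a i ∧ a i ≤ n + L)
    (hinj : Set.InjOn a (Finset.Icc 1 n)) (hb : 0 < b) (hN : 0 < N) {T : Finset ℕ}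
    (hT : ∀ s ∈ T, s ∈ N.smoothNumbers) (hT' : ∀ s ∈ N.smoothNumbers, log s ≤ v → s ∈ T)
    (huw : u ≤ w) (hwv : w ≤ v)
    (hw : b * exp w ≤ n) (hv : (n + L : ℝ) ≤ b * exp v) (hu : (n + L : ℝ) ≤ N * (b * exp u)) :
    2 * (T.filter fun s : ℕ ↦ log s ≤ w).card ≤
      (T.filter fun s : ℕ ↦ log s ≤ v).card + (T.filter fun s : ℕ ↦ log s ≤ u).card := by
  have key := card_smoothNumbers_le_of_injOn hdvd hmem hinj hb hN hT hT' hw hv hu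
  have split {x y : ℝ} (hxy : x ≤ y) : (T.filter fun s : ℕ ↦ log s ≤ y).card =
      (T.filter fun s : ℕ ↦ log s ≤ x).card +
        (T.filter fun s : ℕ ↦ x < log s ∧ log s ≤ y).card := by
    rw [← Finset.card_union_of_disjoint, ← Finset.filter_or]
    · congr 1
      refine Finset.filter_congr fun s _ ↦ ⟨fun h ↦ ?_, fun h ↦ ?_⟩
      · exact (le_or_gt (log s) x).imp id fun h' ↦ ⟨h', h⟩
      · exact h.elim (fun h ↦ h.trans hxy) And.right
    · exact Finset.disjoint_filter.2 fun s _ h h' ↦ h'.1.not_ge h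
  have h₁ := split huw
  have h₂ := split hwv
  omega

theorem exists_f_spec (n m : ℕ) : ∃ a : ℕ → ℕ, (∀ i ∈ Finset.Icc 1 n, i ∣ a i) ∧
    (∀ i ∈ Finset.Icc 1 n, m < a i ∧ a i ≤ m + f n m) ∧ Set.InjOn a (Finset.Icc 1 n) := by
  refine Nat.sInf_mem (s := {L : ℕ | ∃ a : ℕ → ℕ, (∀ i ∈ Finset.Icc 1 n, i ∣ a i) ∧
    (∀ i ∈ Finset.Icc 1 n, m < a i ∧ a i ≤ m + L) ∧ Set.InjOn a (Finset.Icc 1 n)})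
    ⟨n * (m + 1), fun i ↦ i * (m + 1), fun i _ ↦ dvd_mul_right i _, fun i hi ↦ ?_,
      fun i _ j _ hij ↦ Nat.eq_of_mul_eq_mul_right m.succ_pos hij⟩
  obtain ⟨h₁, h₂⟩ := Finset.mem_Icc.1 hi
  constructor
  · nlinarith
  · nlinarith [Nat.mul_le_mul_right (m + 1) h₂]

theorem two_sub_exp_le_of_add_f_le {n N : ℕ} {X B h₁ h₂ μ θ : ℝ} (hn : 0 < n) (hN : 0 < N)
    (hX : (n + f n n : ℝ) ≤ n * X) (hB : 1 < B) (hXB : X ≤ (1 - B⁻¹) * exp h₁)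
    (hh₁ : 0 ≤ h₁) (hh₂ : 0 ≤ h₂) (hhN : exp (h₁ + h₂) ≤ N)
    (hμ : 0 < μ) (hθ : 0 < θ) (hθ1 : θ ≤ 1) :
    2 - exp (μ * h₁) - exp (-μ * h₂) ≤
      2 * exp (-((1 - θ) * μ * (log n - log B))) * θ⁻¹ ^ N.primesBelow.card := by
  obtain ⟨a, hdvd, hmem, hinj⟩ := exists_f_spec n n
  refine two_sub_exp_le_of_smoothNumbers hμ hθ hθ1 fun T hT hT' w hw ↦ ?_
  have hn' : (0 : ℝ) < n := by exact_mod_cast hn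
  have hB0 : 0 < B := one_pos.trans hB
  set t : ℝ := n * exp (-w) with ht
  have htw : t * exp w = n := by rw [ht, mul_assoc, ← exp_add]; simp
  have hBt : B ≤ t := by
    calc B = exp (log n) * exp (-(log n - log B)) := by
          rw [← exp_add]; simp [exp_log hB0]
      _ ≤ t := by rw [exp_log hn', ht]; gcongr
  have htb : t - 1 < ⌊t⌋₊ := by linarith [Nat.lt_floor_add_one t]
  have hb0 : (0 : ℝ) < ⌊t⌋₊ := by linarith
  have htb' : t * (1 - B⁻¹) ≤ ⌊t⌋₊ := by
    have : 1 ≤ t * B⁻¹ := by rw [← div_eq_mul_inv, one_le_div hB0]; exact hBt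
    linarith
  have hv : (n + f n n : ℝ) ≤ ⌊t⌋₊ * exp (w + h₁) := by
    calc (n + f n n : ℝ) ≤ n * ((1 - B⁻¹) * exp h₁) := hX.trans (by gcongr)
      _ = t * (1 - B⁻¹) * exp (w + h₁) := by rw [← htw, exp_add]; ring
      _ ≤ _ := by gcongr
  refine two_mul_card_smoothNumbers_le_of_injOn hdvd hmem hinj (b := ⌊t⌋₊)
    (by exact_mod_cast hb0) hN hT (fun s hs h ↦ hT' s hs (by linarith)) (by linarith)
    (by linarith) ?_ hv (hv.trans ?_)
  · rw [← htw]
    gcongr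
    exact Nat.floor_le (by positivity)
  · calc (⌊t⌋₊ : ℝ) * exp (w + h₁) = exp (h₁ + h₂) * (⌊t⌋₊ * exp (w - h₂)) := by
          rw [mul_left_comm, ← exp_add]; congr 2; ring
      _ ≤ _ := by gcongr

theorem exp_le_one_add_add_sq_add_cube {x : ℝ} (h₀ : 0 ≤ x) (h₁ : x ≤ 1) :
    exp x ≤ 1 + x + x ^ 2 / 2 + x ^ 3 := by
  have := Real.exp_bound' h₀ h₁ (n := 3) (by norm_num)
  simp only [Finset.sum_range_succ, Finset.sum_range_zero] at this
  norm_num [Nat.factorial] at this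
  nlinarith [pow_nonneg h₀ 3]

theorem exp_neg_le_one_sub_add_sq {x : ℝ} (h₀ : 0 ≤ x) :
    exp (-x) ≤ 1 - x + x ^ 2 / 2 := by
  have h := Real.quadratic_le_exp_of_nonneg h₀
  have h' : 0 < 1 + x + x ^ 2 / 2 := by positivity
  rw [exp_neg]
  refine (inv_anti₀ h' h).trans ?_
  rw [inv_le_iff_one_le_mul₀ h']
  nlinarith [pow_nonneg h₀ 4]

theorem le_two_sub_exp_sub_exp_neg {η l : ℝ} (hη : 0 < η) (hη1 : η ≤ 1) (hl : 52 / η ≤ l) :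
    2 * η / l ^ 2 < 2 - exp (4 * (1 + η) / l ^ 2 * (l / 2 - 1 / 2 - η)) -
      exp (-(4 * (1 + η) / l ^ 2) * (l / 2 + 1 / 2 + η)) := by
  have hl' : 52 ≤ l * η := by rwa [div_le_iff₀ hη] at hl
  have hl52 : 52 ≤ l := by nlinarith
  have hl0 : 0 < l := by linarith
  set μ := 4 * (1 + η) / l ^ 2 with hμ
  have hμ0 : 0 < μ := by positivity
  have hμl : μ * l ^ 2 = 4 * (1 + η) := by rw [hμ]; field_simp
  have hμl' : μ * l * 52 ≤ 8 := by
    calc μ * l * 52 ≤ μ * l * l := by gcongr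
      _ = μ * l ^ 2 := by ring
      _ ≤ 8 := by linarith
  have hx0 : 0 ≤ μ * (l / 2 - 1 / 2 - η) := mul_nonneg hμ0.le (by linarith)
  have hx1 : μ * (l / 2 - 1 / 2 - η) ≤ μ * l / 2 := by nlinarith
  have h₁ := exp_le_one_add_add_sq_add_cube hx0 (by linarith)
  have h₂ := exp_neg_le_one_sub_add_sq (x := μ * (l / 2 + 1 / 2 + η)) (by positivity)
  rw [neg_mul]
  have h₃ : (μ * (l / 2 - 1 / 2 - η)) ^ 3 ≤ (μ * l / 2) ^ 3 := by gcongr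
  have h₄ : (μ * l / 2) ^ 3 ≤ μ * (η * (8 / 52)) := by
    have e : (μ * l / 2) ^ 3 * l = μ * ((μ * l ^ 2) ^ 2 / 8) := by ring
    rw [hμl] at e
    have : (4 * (1 + η)) ^ 2 / 8 ≤ 8 := by nlinarith
    refine le_of_mul_le_mul_right ?_ hl0
    rw [e, mul_assoc]
    gcongr
    nlinarith
  have h₅ : (μ * (l / 2 - 1 / 2 - η)) ^ 2 / 2 + (μ * (l / 2 + 1 / 2 + η)) ^ 2 / 2 =
      μ * ((1 + η) + μ * (1 + 2 * η) ^ 2 / 4) := by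
    linear_combination μ / 4 * hμl
  have h₆ : μ * (1 + 2 * η) ^ 2 / 4 ≤ η * (18 / 52) := by
    have : μ * (52 * l) ≤ 8 := by linarith
    have h : (1 + 2 * η) ^ 2 ≤ 9 := by nlinarith
    have h' : μ ≤ η * (8 / 52) := by
      refine le_of_mul_le_mul_right (?_ : μ * l ≤ _) hl0
      nlinarith
    nlinarith
  have h₇ : 2 * η / l ^ 2 < μ * (η / 2) := by
    rw [hμ, div_lt_iff₀ (by positivity)]
    field_simp
    nlinarith
  have h₈ : μ * ((1 + η) + μ * (1 + 2 * η) ^ 2 / 4) ≤ μ * ((1 + η) + η * (18 / 52)) := by gcongr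
  have h₉ : 0 < μ * η := by positivity
  nlinarith

theorem eventually_two_mul_exp_mul_pow_lt {η : ℝ} (hη : 0 < η) (hη1 : η ≤ 1) :
    ∀ᶠ l : ℝ in atTop, ∀ (M W : ℝ) (k : ℕ), l * exp l ≤ 4 * M → (1 - η / 8) * M ≤ W →
      (k : ℝ) ≤ (1 + η / 8) * (4 * M / l ^ 2) →
      2 * exp (-((1 - (1 - η / 8)) * (4 * (1 + η) / l ^ 2) * W)) * (1 - η / 8)⁻¹ ^ k <
        2 * η / l ^ 2 := by
  filter_upwards [(tendsto_exp_div_pow_atTop 3).eventually_ge_atTop (32 / η ^ 3),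
    eventually_gt_atTop 0] with l hl hl0 M W k hM hW hk
  have hδ : 0 < 1 - η / 8 := by linarith
  set Q := 4 * M / l ^ 2 with hQ
  have hQl : exp l / l ≤ Q := by
    rw [hQ, div_le_div_iff₀ hl0 (by positivity)]
    nlinarith
  have hQ0 : 0 < Q := lt_of_lt_of_le (by positivity) hQl
  have hlog : log (1 - η / 8)⁻¹ ≤ η / 8 / (1 - η / 8) := by
    refine (log_le_sub_one_of_pos (inv_pos.2 hδ)).trans_eq ?_
    rw [eq_div_iff hδ.ne', sub_mul, inv_mul_cancel₀ hδ.ne']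
    ring
  have hpow : (1 - η / 8)⁻¹ ^ k ≤ exp ((1 + η / 8) * Q * (η / 8 / (1 - η / 8))) := by
    rw [← exp_log (pow_pos (inv_pos.2 hδ) k), log_pow]
    gcongr
    exact log_nonneg ((one_le_inv₀ hδ).2 (by linarith))
  have hW' : η / 8 * (1 + η) * (1 - η / 8) * Q ≤
      (1 - (1 - η / 8)) * (4 * (1 + η) / l ^ 2) * W := by
    calc η / 8 * (1 + η) * (1 - η / 8) * Q
        = (1 - (1 - η / 8)) * (4 * (1 + η) / l ^ 2) * ((1 - η / 8) * M) := by rw [hQ]; ring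
      _ ≤ _ := by
        have : 0 ≤ 1 - (1 - η / 8) := by linarith
        gcongr
  have hfrac : (1 + η / 8) / (1 - η / 8) ≤ 1 + 3 * (η / 8) := by
    rw [div_le_iff₀ hδ]
    nlinarith
  have hexp : -((1 - (1 - η / 8)) * (4 * (1 + η) / l ^ 2) * W) +
      (1 + η / 8) * Q * (η / 8 / (1 - η / 8)) ≤ -(η ^ 2 / 32 * Q) := by
    have e : (1 + η / 8) * Q * (η / 8 / (1 - η / 8)) =
        η / 8 * Q * ((1 + η / 8) / (1 - η / 8)) := by ring
    have h : η / 8 * Q * ((1 + η / 8) / (1 - η / 8)) ≤ η / 8 * Q * (1 + 3 * (η / 8)) := by gcongr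
    have h' : η / 8 * Q * (η / 4) ≤ η / 8 * Q * ((1 + η) * (1 - η / 8) - (1 + 3 * (η / 8))) := by
      gcongr
      nlinarith
    rw [e]
    nlinarith
  have hz : l ^ 2 / η ≤ η ^ 2 / 32 * Q := by
    calc l ^ 2 / η = η ^ 2 / 32 * (32 / η ^ 3 * l ^ 3 / l) := by field_simp
      _ ≤ η ^ 2 / 32 * (exp l / l) := by
        gcongr
        rwa [le_div_iff₀ (by positivity)] at hl
      _ ≤ _ := by gcongr
  calc _ ≤ 2 * exp (-((1 - (1 - η / 8)) * (4 * (1 + η) / l ^ 2) * W)) *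
        exp ((1 + η / 8) * Q * (η / 8 / (1 - η / 8))) := by gcongr
    _ = 2 * exp (-((1 - (1 - η / 8)) * (4 * (1 + η) / l ^ 2) * W) +
        (1 + η / 8) * Q * (η / 8 / (1 - η / 8))) := by rw [exp_add, mul_assoc]
    _ ≤ 2 * exp (-(l ^ 2 / η)) := by
      gcongr
      linarith
    _ < 2 * (l ^ 2 / η)⁻¹ := by
      rw [exp_neg]
      gcongr
      linarith [add_one_le_exp (l ^ 2 / η)]
    _ = 2 * η / l ^ 2 := by rw [inv_div]; ring

theorem tendsto_div_log_atTop : Tendsto (fun x : ℝ ↦ x / log x) atTop atTop := by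
  refine ((tendsto_exp_div_pow_atTop 1).comp tendsto_log_atTop).congr' ?_
  filter_upwards [eventually_gt_atTop 0] with x hx
  simp [exp_log hx]

theorem card_primesBelow_ceil_le (y : ℝ) :
    (Nat.primesBelow ⌈y⌉₊).card ≤ Nat.primeCounting ⌊y⌋₊ := by
  rw [Nat.primesBelow_card_eq_primeCounting', Nat.primeCounting]
  exact Nat.monotone_primeCounting' (Nat.ceil_le_floor_add_one y)

theorem stmt_3 : ∀ ε : ℝ, ε > 0 → ∃ N : ℕ, ∀ n : ℕ, N ≤ n → 0 < n →
    (f n n : ℝ) > (2 / Real.sqrt (Real.exp 1) - ε) * n *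
      Real.sqrt (Real.log n / Real.log (Real.log n)) := by
  intro ε hε
  obtain ⟨η, hη, hη1, hηε⟩ : ∃ η : ℝ, 0 < η ∧ η ≤ 1 ∧ η ≤ ε / 8 :=
    ⟨min 1 (ε / 8), by positivity, min_le_left _ _, min_le_right _ _⟩
  have hexpη : exp (-η) < 1 := exp_lt_one_iff.2 (by linarith)
  set B : ℝ := (1 - exp (-η))⁻¹ with hB
  have hB1 : 1 < B := (one_lt_inv₀ (by linarith)).2 (by linarith [exp_pos (-η)])
  have hM : Tendsto (fun n : ℕ ↦ log n) atTop atTop :=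
    tendsto_log_atTop.comp tendsto_natCast_atTop_atTop
  have hq := tendsto_div_log_atTop.comp hM
  have hy : Tendsto (fun n : ℕ ↦ 4 * (log n / log (log n))) atTop atTop :=
    hq.const_mul_atTop (by norm_num)
  have hl := tendsto_log_atTop.comp hy
  have hR := tendsto_sqrt_atTop.comp hq
  refine eventually_atTop.1 ?_
  filter_upwards [hl.eventually (eventually_two_mul_exp_mul_pow_lt hη hη1),
    hl.eventually_ge_atTop (52 / η),
    hy.eventually (eventually_primeCounting_le_one_add (ε := η / 8) (by positivity)),
    hR.eventually_ge_atTop (2 / ε), (tendsto_log_atTop.comp hM).eventually_ge_atTop 4,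
    hM.eventually_ge_atTop (log B / (η / 8)), hM.eventually_gt_atTop 0, hy.eventually_gt_atTop 0]
    with n hn₁ hn₂ hn₃ hn₄ hn₅ hn₆ hn₇ hn₈ hn
  simp only [Function.comp_apply] at hn₁ hn₂ hn₃ hn₄ hn₅ hn₆ hn₇ hn₈
  by_contra! hf
  have hn' : (0 : ℝ) < n := by exact_mod_cast hn
  set M := log n with hMdef
  set R := √(M / log M) with hRdef
  set y := 4 * (M / log M) with hydef
  set l := log y with hldef
  have hl52 : 52 ≤ l := by
    refine le_trans ?_ hn₂
    rw [le_div_iff₀ hη]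
    linarith
  have hR0 : 0 ≤ R := sqrt_nonneg _
  have hlM : l ≤ log M := by
    refine log_le_log hn₈ ?_
    rw [hydef, ← mul_div_assoc, div_le_iff₀ (by linarith)]
    nlinarith
  have hyl : exp l = y := exp_log hn₈
  have hyM : y * log M = 4 * M := by
    rw [hydef]
    field_simp
  have hexp2 : 2 * R = exp (l / 2) := by
    rw [exp_half, hyl, hydef, sqrt_mul (by norm_num), ← hRdef]
    congr 1
    rw [show (4 : ℝ) = 2 ^ 2 by norm_num, sqrt_sq (by norm_num)]
  have hsq : 2 / √(exp 1) = 2 * exp (-(1 / 2)) := by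
    rw [← exp_half, exp_neg, div_eq_mul_inv]
  have hX : (n + f n n : ℝ) ≤ n * ((2 * exp (-(1 / 2)) - ε / 2) * R) := by
    rw [hsq] at hf
    have : 1 ≤ ε / 2 * R := by
      rw [div_le_iff₀ hε] at hn₄
      linarith
    nlinarith
  have hXB : (2 * exp (-(1 / 2)) - ε / 2) * R ≤ (1 - B⁻¹) * exp (l / 2 - 1 / 2 - η) := by
    calc (2 * exp (-(1 / 2)) - ε / 2) * R ≤ (2 * exp (-(1 / 2)) * exp (-(2 * η))) * R := by
          gcongr
          have h₁ := add_one_le_exp (-(2 * η))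
          have h₂ : exp (-(1 / 2)) ≤ 1 := exp_le_one_iff.2 (by norm_num)
          have h₃ := exp_pos (-(1 / 2))
          nlinarith
      _ = exp (-η) * exp (l / 2 - 1 / 2 - η) := by
          rw [mul_assoc 2, ← exp_add, mul_right_comm, hexp2, ← exp_add, ← exp_add]
          ring_nf
      _ = _ := by rw [hB, inv_inv]; ring
  have hN : y ≤ ⌈y⌉₊ := Nat.le_ceil y
  have key := two_sub_exp_le_of_add_f_le (N := ⌈y⌉₊) (h₂ := l / 2 + 1 / 2 + η)
    (μ := 4 * (1 + η) / l ^ 2) (θ := 1 - η / 8) hn (Nat.ceil_pos.2 hn₈) hX hB1 hXB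
    (by linarith) (by linarith)
    (by rwa [show l / 2 - 1 / 2 - η + (l / 2 + 1 / 2 + η) = l by ring, hyl])
    (by positivity) (by linarith) (by linarith)
  refine absurd key (not_le.2 (lt_trans (hn₁ M _ _ ?_ ?_ ?_)
    (le_two_sub_exp_sub_exp_neg hη hη1 hn₂)))
  · rw [hyl, ← hyM, mul_comm]
    gcongr
  · rw [div_le_iff₀ (by positivity)] at hn₆
    linarith
  · calc ((Nat.primesBelow ⌈y⌉₊).card : ℝ) ≤ Nat.primeCounting ⌊y⌋₊ := by
          exact_mod_cast card_primesBelow_ceil_le y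
      _ ≤ (1 + η / 8) * y / l := hn₃
      _ ≤ _ := by
        rw [← hyM, mul_div_assoc]
        refine mul_le_mul_of_nonneg_left ?_ (by linarith)
        rw [div_le_div_iff₀ (by linarith) (by positivity)]
        calc y * l ^ 2 = y * l * l := by ring
          _ ≤ y * log M * l := by gcongr
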